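/- Let E be a geodesic metric space without bifurcating geodesics, let A be a nonempty subset of E, and suppose a₁∈A and x₁∈E satisfy d(x₁,a₁) ≤ d(x₁,a) for all a∈A. Let x' be a point on a geodesic segment joining x₁ and a₁ with 0 < d(x₁,x') < d(x₁,a₁). Then d(x',a₁) = dist(x',A) and a₁ is the unique nearest point of x' in A: for every a∈A with d(x',a) = dist(x',A) one has a = a₁. -/

import Mathlib

open Metric Set Filter Bornology

noncomputable section

/-- A geodesic path of length `l`: a map `c : ℝ → E` that is isometric on `[0, l]`. -/
def IsGeodesicPath {E : Type*} [MetricSpace E] (c : ℝ → E) (l : ℝ) : Prop :=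
  0 ≤ l ∧ ∀ s ∈ Icc (0:ℝ) l, ∀ t ∈ Icc (0:ℝ) l, dist (c s) (c t) = |s - t|

/-- `S` is a geodesic segment joining `x` and `y`. -/
def IsGeodesicSegment {E : Type*} [MetricSpace E] (S : Set E) (x y : E) : Prop :=
  ∃ c l, IsGeodesicPath c l ∧ c 0 = x ∧ c l = y ∧ S = c '' Icc (0:ℝ) l

/-- A geodesic (line): an isometric image of `ℝ`. -/
def IsGeodesicLine {E : Type*} [MetricSpace E] (S : Set E) : Prop :=
  ∃ c : ℝ → E, Isometry c ∧ S = Set.range c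

/-- `E` is a geodesic space: every two points are joined by a geodesic path. -/
def IsGeodesicSpace (E : Type*) [MetricSpace E] : Prop :=
  ∀ x y : E, ∃ S, IsGeodesicSegment S x y

/-- `E` has the geodesic extension property: every geodesic segment is contained
in a geodesic. -/
def GeodesicExtensionProperty (E : Type*) [MetricSpace E] : Prop :=
  ∀ (S : Set E) (x y : E), IsGeodesicSegment S x y → ∃ L, IsGeodesicLine L ∧ S ⊆ L

/-- The metric of `E` is convex. -/
def HasConvexMetric (E : Type*) [MetricSpace E] : Prop :=
  ∀ (c₁ c₂ : ℝ → E) (l₁ l₂ : ℝ), IsGeodesicPath c₁ l₁ → IsGeodesicPath c₂ l₂ →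
    ∀ t ∈ Icc (0:ℝ) 1,
      dist (c₁ (t * l₁)) (c₂ (t * l₂)) ≤
        (1 - t) * dist (c₁ 0) (c₂ 0) + t * dist (c₁ l₁) (c₂ l₂)

/-- A subset `X` is (geodesically) convex: any geodesic segment joining two points
of `X` is contained in `X`. -/
def GeodesicConvex {E : Type*} [MetricSpace E] (X : Set E) : Prop :=
  ∀ x ∈ X, ∀ y ∈ X, ∀ S : Set E, IsGeodesicSegment S x y → S ⊆ X

/-- A function `f : E → ℝ` is (geodesically) convex. -/
def GeodesicConvexFun {E : Type*} [MetricSpace E] (f : E → ℝ) : Prop :=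
  ∀ (c : ℝ → E) (l : ℝ), IsGeodesicPath c l → ∀ t ∈ Icc (0:ℝ) 1,
    f (c (t * l)) ≤ (1 - t) * f (c 0) + t * f (c l)

/-- `G₁(S)`: the union of all geodesic segments with endpoints in `S`. -/
def geodSegUnion {E : Type*} [MetricSpace E] (S : Set E) : Set E :=
  {z | ∃ x ∈ S, ∃ y ∈ S, ∃ T : Set E, IsGeodesicSegment T x y ∧ z ∈ T}

/-- The iterates `G_n(S)`. -/
def geodGn {E : Type*} [MetricSpace E] (S : Set E) : ℕ → Set E
  | 0 => S
  | n + 1 => geodSegUnion (geodGn S n)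

/-- The (geodesic) convex hull `co(S) = ⋃ₙ G_n(S)`. -/
def geodConvexHull {E : Type*} [MetricSpace E] (S : Set E) : Set E :=
  ⋃ n, geodGn S n

/-- `E` is without bifurcating geodesics. -/
def NoBifurcatingGeodesics (E : Type*) [MetricSpace E] : Prop :=
  ∀ (p a b : E) (S₁ S₂ : Set E), IsGeodesicSegment S₁ p a → IsGeodesicSegment S₂ p b →
    ∀ z, z ∈ S₁ → z ∈ S₂ → z ≠ p → (z = a ∧ z = b) ∨ S₁ ⊆ S₂ ∨ S₂ ⊆ S₁

/-- `E` is reflexive: every descending sequence of nonempty, bounded, closed and convex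
subsets of `E` has nonempty intersection. -/
def ReflexiveGeodesicSpace (E : Type*) [MetricSpace E] : Prop :=
  ∀ C : ℕ → Set E, (∀ n, (C n).Nonempty) → (∀ n, IsBounded (C n)) → (∀ n, IsClosed (C n)) →
    (∀ n, GeodesicConvex (C n)) → (∀ n, C (n + 1) ⊆ C n) → (⋂ n, C n).Nonempty

/-- `Dist(x, A)`: the remotal (farthest) distance from `x` to `A`. -/
def supDist {E : Type*} [MetricSpace E] (x : E) (A : Set E) : ℝ :=
  sSup ((fun a => dist x a) '' A)

/-- `λ_{XY} = inf{ d(x,y) : x ∈ X, y ∈ Y }`. -/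
def infSetDist {E : Type*} [MetricSpace E] (X Y : Set E) : ℝ :=
  sInf (Set.image2 dist X Y)

/-- `μ_{XY} = sup{ d(x,y) : x ∈ X, y ∈ Y }`. -/
def supSetDist {E : Type*} [MetricSpace E] (X Y : Set E) : ℝ :=
  sSup (Set.image2 dist X Y)

/-- `L_{XY}(σ) = { x ∈ X : dist(x,Y) ≤ λ_{XY} + σ }`. -/
def Lset {E : Type*} [MetricSpace E] (X Y : Set E) (σ : ℝ) : Set E :=
  {x ∈ X | infDist x Y ≤ infSetDist X Y + σ}

/-- `M_{XY}(σ) = { x ∈ X : Dist(x,Y) ≥ μ_{XY} − σ }`. -/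
def Mset {E : Type*} [MetricSpace E] (X Y : Set E) (σ : ℝ) : Set E :=
  {x ∈ X | supSetDist X Y - σ ≤ supDist x Y}

/-- The minimization problem `min(X,Y)` is well-posed. -/
def MinWellPosed {E : Type*} [MetricSpace E] (X Y : Set E) : Prop :=
  ∃ x₀ ∈ X, ∃ y₀ ∈ Y, dist x₀ y₀ = infSetDist X Y ∧
    (∀ x ∈ X, ∀ y ∈ Y, dist x y = infSetDist X Y → x = x₀ ∧ y = y₀) ∧
    ∀ x : ℕ → E, ∀ y : ℕ → E, (∀ n, x n ∈ X) → (∀ n, y n ∈ Y) →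
      Tendsto (fun n => dist (x n) (y n)) atTop (nhds (infSetDist X Y)) →
      Tendsto x atTop (nhds x₀) ∧ Tendsto y atTop (nhds y₀)

/-- The maximization problem `max(X,Y)` is well-posed. -/
def MaxWellPosed {E : Type*} [MetricSpace E] (X Y : Set E) : Prop :=
  ∃ x₀ ∈ X, ∃ y₀ ∈ Y, dist x₀ y₀ = supSetDist X Y ∧
    (∀ x ∈ X, ∀ y ∈ Y, dist x y = supSetDist X Y → x = x₀ ∧ y = y₀) ∧
    ∀ x : ℕ → E, ∀ y : ℕ → E, (∀ n, x n ∈ X) → (∀ n, y n ∈ Y) →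
      Tendsto (fun n => dist (x n) (y n)) atTop (nhds (supSetDist X Y)) →
      Tendsto x atTop (nhds x₀) ∧ Tendsto y atTop (nhds y₀)

/-- The distance of the model space `M²_κ` (κ < 0): the hyperbolic distance
multiplied by `1/√(-κ)`. -/
def kdist (κ : ℝ) (a b : UpperHalfPlane) : ℝ :=
  (Real.sqrt (-κ))⁻¹ * dist a b

/-- `pb` is the comparison point in `M²_κ` (relative to the side from `xi` to `xj`,
with comparison vertices `xib`, `xjb`) of a point `p` on a geodesic segment from
`xi` to `xj`. -/
def IsComparisonPoint {E : Type*} [MetricSpace E] (κ : ℝ) (xi xj : E)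
    (xib xjb : UpperHalfPlane) (p : E) (pb : UpperHalfPlane) : Prop :=
  kdist κ xib pb = dist xi p ∧ kdist κ pb xjb = dist p xj

/-- `E` has curvature bounded below by `κ < 0`: every geodesic triangle satisfies the
reversed CAT(κ) inequality with respect to any κ-comparison triangle in `M²_κ`. -/
def CurvBoundedBelow (E : Type*) [MetricSpace E] (κ : ℝ) : Prop :=
  ∀ (x₁ x₂ x₃ : E) (S₁₂ S₂₃ S₁₃ : Set E),
    IsGeodesicSegment S₁₂ x₁ x₂ → IsGeodesicSegment S₂₃ x₂ x₃ → IsGeodesicSegment S₁₃ x₁ x₃ →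
    ∀ x₁b x₂b x₃b : UpperHalfPlane,
      kdist κ x₁b x₂b = dist x₁ x₂ → kdist κ x₂b x₃b = dist x₂ x₃ →
      kdist κ x₁b x₃b = dist x₁ x₃ →
      ∀ (p q : E) (pb qb : UpperHalfPlane),
        ((p ∈ S₁₂ ∧ IsComparisonPoint κ x₁ x₂ x₁b x₂b p pb) ∨
         (p ∈ S₂₃ ∧ IsComparisonPoint κ x₂ x₃ x₂b x₃b p pb) ∨
         (p ∈ S₁₃ ∧ IsComparisonPoint κ x₁ x₃ x₁b x₃b p pb)) →
        ((q ∈ S₁₂ ∧ IsComparisonPoint κ x₁ x₂ x₁b x₂b q qb) ∨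
         (q ∈ S₂₃ ∧ IsComparisonPoint κ x₂ x₃ x₂b x₃b q qb) ∨
         (q ∈ S₁₃ ∧ IsComparisonPoint κ x₁ x₃ x₁b x₃b q qb)) →
        kdist κ pb qb ≤ dist p q

/-- Comparison points for Euclidean (κ = 0) comparison triangles in `ℝ²`. -/
def IsComparisonPointE {E : Type*} [MetricSpace E] (xi xj : E)
    (xib xjb : EuclideanSpace ℝ (Fin 2)) (p : E) (pb : EuclideanSpace ℝ (Fin 2)) : Prop :=
  dist xib pb = dist xi p ∧ dist pb xjb = dist p xj

/-- `E` is a CAT(0) space: a geodesic space where every geodesic triangle satisfies the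
CAT(0) comparison inequality with respect to Euclidean comparison triangles. -/
def CATZero (E : Type*) [MetricSpace E] : Prop :=
  IsGeodesicSpace E ∧
  ∀ (x₁ x₂ x₃ : E) (S₁₂ S₂₃ S₁₃ : Set E),
    IsGeodesicSegment S₁₂ x₁ x₂ → IsGeodesicSegment S₂₃ x₂ x₃ → IsGeodesicSegment S₁₃ x₁ x₃ →
    ∀ x₁b x₂b x₃b : EuclideanSpace ℝ (Fin 2),
      dist x₁b x₂b = dist x₁ x₂ → dist x₂b x₃b = dist x₂ x₃ → dist x₁b x₃b = dist x₁ x₃ →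
      ∀ (p q : E) (pb qb : EuclideanSpace ℝ (Fin 2)),
        ((p ∈ S₁₂ ∧ IsComparisonPointE x₁ x₂ x₁b x₂b p pb) ∨
         (p ∈ S₂₃ ∧ IsComparisonPointE x₂ x₃ x₂b x₃b p pb) ∨
         (p ∈ S₁₃ ∧ IsComparisonPointE x₁ x₃ x₁b x₃b p pb)) →
        ((q ∈ S₁₂ ∧ IsComparisonPointE x₁ x₂ x₁b x₂b q qb) ∨
         (q ∈ S₂₃ ∧ IsComparisonPointE x₂ x₃ x₂b x₃b q qb) ∨
         (q ∈ S₁₃ ∧ IsComparisonPointE x₁ x₃ x₁b x₃b q qb)) →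
        dist p q ≤ dist pb qb

/-- The space `P_{b,cl,cv}(E)` of nonempty, bounded, closed and convex subsets of `E`. -/
def Pbclcv (E : Type*) [MetricSpace E] : Type _ :=
  {X : Set E // X.Nonempty ∧ IsBounded X ∧ IsClosed X ∧ GeodesicConvex X}

/-- `P_{b,cl,cv}(E)` carries the Pompeiu-Hausdorff distance. -/
instance Pbclcv.metricSpace (E : Type*) [MetricSpace E] : MetricSpace (Pbclcv E) where
  dist X Y := hausdorffDist X.1 Y.1
  dist_self X := hausdorffDist_self_zero
  dist_comm X Y := hausdorffDist_comm
  dist_triangle X Y Z := hausdorffDist_triangle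
    (hausdorffEdist_ne_top_of_nonempty_of_bounded X.2.1 Y.2.1 X.2.2.1 Y.2.2.1)
  eq_of_dist_eq_zero := by
    intro X Y h
    exact Subtype.ext ((X.2.2.2.1.hausdorffDist_zero_iff_eq Y.2.2.2.1
      (hausdorffEdist_ne_top_of_nonempty_of_bounded X.2.1 Y.2.1 X.2.2.1 Y.2.2.1)).mp h)

/-- `P^A_{b,cl,cv}(E)`: the closure in `(P_{b,cl,cv}(E), h)` of the family of sets at
positive distance from `A`. -/
def PAbclcv {E : Type*} [MetricSpace E] (A : Set E) : Set (Pbclcv E) :=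
  closure {X : Pbclcv E | 0 < infSetDist X.1 A}

/-- The inverse hyperbolic cosine. -/
def arcosh (x : ℝ) : ℝ := Real.log (x + Real.sqrt (x ^ 2 - 1))

/-- The function `F_κ`. -/
def Fkappa (κ d r σ : ℝ) : ℝ :=
  2 / Real.sqrt (-κ) *
    arcosh (Real.cosh (Real.sqrt (-κ) * (r - d + σ)) ^ 2 -
      Real.sinh (Real.sqrt (-κ) * (r - d + σ)) / Real.sinh (Real.sqrt (-κ) * d) *
        (Real.cosh (Real.sqrt (-κ) * r) -
          Real.cosh (Real.sqrt (-κ) * d) * Real.cosh (Real.sqrt (-κ) * (r - d + σ))))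

/-- The petal `P_{α,δ}(x₀, f)`. -/
def petal {E : Type*} [MetricSpace E] (f : E → ℝ) (α δ : ℝ) (x₀ : E) : Set E :=
  {x | f x ≤ f x₀ - α * dist x x₀ + δ}

/-- `L_{A,f}(σ)`. -/
def LsetFun {E : Type*} [MetricSpace E] (A : Set E) (f : E → ℝ) (σ : ℝ) : Set E :=
  {x | f x ≤ sInf (f '' A) + σ ∧ infDist x A ≤ σ}

/-- The problem `min(A,f)` is well-posed in the sense of Revalski. -/
def RevalskiWellPosed {E : Type*} [MetricSpace E] (A : Set E) (f : E → ℝ) : Prop :=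
  sInf ((fun σ => diam (LsetFun A f σ)) '' Ioi 0) = 0

/-- The nearest point problem `min(X,y)` is well-posed. -/
def PointMinWellPosed {E : Type*} [MetricSpace E] (X : Set E) (y : E) : Prop :=
  ∃ x₀ ∈ X, dist x₀ y = infDist y X ∧ (∀ x ∈ X, dist x y = infDist y X → x = x₀) ∧
    ∀ x : ℕ → E, (∀ n, x n ∈ X) →
      Tendsto (fun n => dist (x n) y) atTop (nhds (infDist y X)) →
      Tendsto x atTop (nhds x₀)

end

lemma IsGeodesicPath.dist_endpoints {E : Type*} [MetricSpace E] {c : ℝ → E} {l : ℝ}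
    (hc : IsGeodesicPath c l) : dist (c 0) (c l) = l := by
  rw [hc.2 0 ⟨le_rfl, hc.1⟩ l ⟨hc.1, le_rfl⟩, zero_sub, abs_neg, abs_of_nonneg hc.1]

lemma IsGeodesicPath.mono {E : Type*} [MetricSpace E] {c : ℝ → E} {l t : ℝ}
    (hc : IsGeodesicPath c l) (ht : t ∈ Icc 0 l) : IsGeodesicPath c t :=
  ⟨ht.1, fun r hr s hs => hc.2 r ⟨hr.1, hr.2.trans ht.2⟩ s ⟨hs.1, hs.2.trans ht.2⟩⟩

/-- The concatenation of two geodesic paths is geodesic as soon as the distance between its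
endpoints is the sum of the lengths. -/
lemma IsGeodesicPath.concat {E : Type*} [MetricSpace E] {c₁ c₂ : ℝ → E} {l₁ l₂ : ℝ}
    (h₁ : IsGeodesicPath c₁ l₁) (h₂ : IsGeodesicPath c₂ l₂) (hc : c₁ l₁ = c₂ 0)
    (hd : dist (c₁ 0) (c₂ l₂) = l₁ + l₂) :
    IsGeodesicPath (fun t => if t ≤ l₁ then c₁ t else c₂ (t - l₁)) (l₁ + l₂) := by
  have hl₁ := h₁.1
  have hl₂ := h₂.1
  have cross : ∀ s ∈ Icc 0 l₁, ∀ t ∈ Icc 0 l₂, dist (c₁ s) (c₂ t) = l₁ + t - s := by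
    intro s hs t ht
    have e₁ := h₁.2 0 ⟨le_rfl, hl₁⟩ s hs
    have e₂ := h₁.2 s hs l₁ ⟨hl₁, le_rfl⟩
    have e₃ := h₂.2 0 ⟨le_rfl, hl₂⟩ t ht
    have e₄ := h₂.2 t ht l₂ ⟨hl₂, le_rfl⟩
    rw [abs_of_nonpos (by linarith [hs.1])] at e₁
    rw [abs_of_nonpos (by linarith [hs.2]), hc] at e₂
    rw [abs_of_nonpos (by linarith [ht.1])] at e₃
    rw [abs_of_nonpos (by linarith [ht.2])] at e₄
    have upper := dist_triangle (c₁ s) (c₂ 0) (c₂ t)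
    have lower := dist_triangle4 (c₁ 0) (c₁ s) (c₂ t) (c₂ l₂)
    linarith
  refine ⟨by linarith, fun s hs t ht => ?_⟩
  rcases le_or_gt s l₁ with hsl | hsl <;> rcases le_or_gt t l₁ with htl | htl
  · simpa only [if_pos hsl, if_pos htl] using h₁.2 s ⟨hs.1, hsl⟩ t ⟨ht.1, htl⟩
  · simp only [if_pos hsl, if_neg htl.not_ge]
    rw [cross s ⟨hs.1, hsl⟩ (t - l₁) ⟨by linarith, by linarith [ht.2]⟩,
      abs_of_nonpos (by linarith)]
    ring
  · simp only [if_neg hsl.not_ge, if_pos htl]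
    rw [dist_comm, cross t ⟨ht.1, htl⟩ (s - l₁) ⟨by linarith, by linarith [hs.2]⟩,
      abs_of_nonneg (by linarith)]
    ring
  · simp only [if_neg hsl.not_ge, if_neg htl.not_ge]
    rw [h₂.2 (s - l₁) ⟨by linarith, by linarith [hs.2]⟩ (t - l₁)
      ⟨by linarith, by linarith [ht.2]⟩]
    congr 1
    ring

lemma IsGeodesicSegment.dist_add_dist {E : Type*} [MetricSpace E] {S : Set E} {x y z : E}
    (hS : IsGeodesicSegment S x y) (hz : z ∈ S) : dist x z + dist z y = dist x y := by
  obtain ⟨c, l, hc, rfl, rfl, rfl⟩ := hS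
  obtain ⟨t, ht, rfl⟩ := hz
  rw [(hc.mono ht).dist_endpoints, hc.dist_endpoints, hc.2 t ht l ⟨hc.1, le_rfl⟩,
    abs_of_nonpos (by linarith [ht.2])]
  ring

lemma IsGeodesicSegment.right_mem {E : Type*} [MetricSpace E] {S : Set E} {x y : E}
    (hS : IsGeodesicSegment S x y) : y ∈ S := by
  obtain ⟨c, l, hc, rfl, rfl, rfl⟩ := hS
  exact mem_image_of_mem c ⟨hc.1, le_rfl⟩

lemma IsGeodesicSegment.eq_right_of_dist_eq {E : Type*} [MetricSpace E] {S : Set E} {x y z : E}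
    (hS : IsGeodesicSegment S x y) (hz : z ∈ S) (h : dist x z = dist x y) : z = y :=
  dist_eq_zero.1 (by linarith [hS.dist_add_dist hz])

/-- In a geodesic space, a point at which the triangle inequality is an equality lies on a
geodesic segment. -/
lemma IsGeodesicSpace.exists_segment_through {E : Type*} [MetricSpace E]
    (hE : IsGeodesicSpace E) {x y z : E} (h : dist x z + dist z y = dist x y) :
    ∃ S, IsGeodesicSegment S x y ∧ z ∈ S := by
  obtain ⟨-, c₁, l₁, h₁, rfl, hz, -⟩ := hE x z
  obtain ⟨-, c₂, l₂, h₂, hz', rfl, -⟩ := hE z y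
  have hc : c₁ l₁ = c₂ 0 := hz.trans hz'.symm
  have hd : dist (c₁ 0) (c₂ l₂) = l₁ + l₂ := by
    have e₁ := h₁.dist_endpoints
    have e₂ := h₂.dist_endpoints
    rw [hz] at e₁
    rw [hz'] at e₂
    linarith
  have hconcat := h₁.concat h₂ hc hd
  refine ⟨_, ⟨_, _, hconcat, if_pos h₁.1, ?_, rfl⟩, l₁, ⟨h₁.1, by linarith [h₂.1]⟩, ?_⟩
  · rcases h₂.1.eq_or_lt with h0 | h0
    · simp [← h0, hc]
    · simp [h0.not_ge]
  · simp [hz]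

/-- unique nearest point along a geodesic in a space without
bifurcating geodesics. -/
theorem statement18 {E : Type*} [MetricSpace E] (hgeo : IsGeodesicSpace E)
    (hbif : NoBifurcatingGeodesics E)
    (A : Set E) (hA : A.Nonempty) (a₁ : E) (ha₁ : a₁ ∈ A) (x₁ : E)
    (hmin : ∀ a ∈ A, dist x₁ a₁ ≤ dist x₁ a)
    (x' : E) (S : Set E) (hS : IsGeodesicSegment S x₁ a₁) (hx' : x' ∈ S)
    (h1 : 0 < dist x₁ x') (h2 : dist x₁ x' < dist x₁ a₁) :
    dist x' a₁ = infDist x' A ∧ ∀ a ∈ A, dist x' a = infDist x' A → a = a₁ := by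
  have hsum := hS.dist_add_dist hx'
  have hnear : dist x' a₁ = infDist x' A := by
    refine le_antisymm ((le_infDist hA).2 fun a ha => ?_) (infDist_le_dist_of_mem ha₁)
    linarith [hmin a ha, dist_triangle x₁ x' a]
  refine ⟨hnear, fun a ha hda => ?_⟩
  have hda₁ : dist x' a = dist x' a₁ := hda.trans hnear.symm
  have heq : dist x₁ a = dist x₁ a₁ := by
    linarith [hmin a ha, dist_triangle x₁ x' a]
  obtain ⟨T, hT, hxT⟩ := hgeo.exists_segment_through (x := x₁) (y := a) (z := x') (by linarith)
  rcases hbif x₁ a₁ a S T hS hT x' hx' hxT (dist_pos.1 h1).symm with ⟨h, -⟩ | h | h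
  · rw [h] at h2
    exact absurd h2 (lt_irrefl _)
  · exact (hT.eq_right_of_dist_eq (h hS.right_mem) heq.symm).symm
  · exact hS.eq_right_of_dist_eq (h hT.right_mem) heq
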